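/- Let n ≥ 1, i ∈ {1,…,n}, and ε ∈ {−1, 1}. Then P(ε·eᵢ) = {∑_{k=1}^n a_k e_k : a_i = −ε and a_k ∈ {0, −ε} for all k ∈ {1,…,n} \ {i}}. -/

import Mathlib

open Pointwise

section Lattice

/-- The standard dot product on `ℤⁿ`. -/
def dotZ {n : ℕ} (x y : Fin n → ℤ) : ℤ := ∑ i, x i * y i

/-- The set of Demazure roots of a set `S ⊆ ℤⁿ`. -/
def demRoots {n : ℕ} (S : Set (Fin n → ℤ)) : Set (Fin n → ℤ) :=
  {α | ∃ ρ ∈ S, dotZ ρ α = -1 ∧ ∀ ρ' ∈ S, ρ' ≠ ρ → 0 ≤ dotZ ρ' α}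

/-- The standard basis vector `eᵢ` of `ℤⁿ`. -/
def eZ (n : ℕ) (i : Fin n) : Fin n → ℤ := Pi.single i 1

/-- `e₀ := −(e₁ + ⋯ + eₙ)`, i.e. the all-(−1) vector. -/
def e0Z (n : ℕ) : Fin n → ℤ := fun _ => -1

/-- `Sₙ := {e₀, e₁, …, eₙ}`, the 1-skeleton (ray generators) of `ℙⁿ`. -/
def SnZ (n : ℕ) : Set (Fin n → ℤ) := insert (e0Z n) (Set.range (eZ n))

/-- `Rₙ := {eᵢ} ∪ {−eᵢ} ∪ {eᵢ − eⱼ : i ≠ j}`, the root system of `PGL_{n+1}`. -/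
def RnZ (n : ℕ) : Set (Fin n → ℤ) :=
  Set.range (eZ n) ∪ Set.range (fun i => -eZ n i) ∪
    {α | ∃ i j : Fin n, i ≠ j ∧ α = eZ n i - eZ n j}

end Lattice

/-- `P(α)`: the integer vectors pairing to `−1` with `α` and `≥ −1` with every other root
in `Rₙ`. -/
def Pset (n : ℕ) (α : Fin n → ℤ) : Set (Fin n → ℤ) :=
  {p | dotZ p α = -1 ∧ ∀ α' ∈ RnZ n, α' ≠ α → -1 ≤ dotZ p α'}

@[simp]
lemma dotZ_eZ {n : ℕ} (p : Fin n → ℤ) (i : Fin n) : dotZ p (eZ n i) = p i := by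
  simp [dotZ, eZ, Pi.single_apply]

@[simp]
lemma dotZ_neg {n : ℕ} (p q : Fin n → ℤ) : dotZ p (-q) = -dotZ p q := by
  simp [dotZ]

@[simp]
lemma dotZ_sub {n : ℕ} (p q r : Fin n → ℤ) : dotZ p (q - r) = dotZ p q - dotZ p r := by
  simp [dotZ, mul_sub]

@[simp]
lemma dotZ_smul {n : ℕ} (c : ℤ) (p q : Fin n → ℤ) : dotZ p (c • q) = c * dotZ p q := by
  simp [dotZ, Finset.mul_sum, mul_left_comm]

/-- The bound defining `Pset` may be imposed on all roots, since it also holds at `α`. -/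
lemma mem_Pset_iff {n : ℕ} {α p : Fin n → ℤ} :
    p ∈ Pset n α ↔ dotZ p α = -1 ∧ ∀ α' ∈ RnZ n, -1 ≤ dotZ p α' := by
  refine and_congr_right fun hα => forall₂_congr fun α' _ => ⟨fun h => ?_, fun h _ => h⟩
  by_cases hne : α' = α
  · rw [hne, hα]
  · exact h hne

/-- The pairing of `p` with every root is at least `-1` iff the coordinates of `p` and their
differences are bounded accordingly. -/
lemma forall_RnZ_neg_one_le_dotZ_iff {n : ℕ} {p : Fin n → ℤ} :
    (∀ α ∈ RnZ n, -1 ≤ dotZ p α) ↔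
      (∀ k, -1 ≤ p k ∧ p k ≤ 1) ∧ ∀ j k, j ≠ k → -1 ≤ p j - p k := by
  constructor
  · intro h
    refine ⟨fun k => ⟨?_, ?_⟩, fun j k hjk => ?_⟩
    · simpa using h (eZ n k) (.inl (.inl ⟨k, rfl⟩))
    · have := h (-eZ n k) (.inl (.inr ⟨k, rfl⟩))
      rw [dotZ_neg, dotZ_eZ] at this
      omega
    · simpa using h (eZ n j - eZ n k) (.inr ⟨j, k, hjk, rfl⟩)
  · rintro ⟨h, hd⟩ α ((⟨k, rfl⟩ | ⟨k, rfl⟩) | ⟨j, k, hjk, rfl⟩)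
    · simpa using (h k).1
    · simpa using (h k).2
    · simpa using hd j k hjk

/-- Description of `P(ε·eᵢ)`. -/
theorem Pset_eps_ei (n : ℕ) (hn : 1 ≤ n) (i : Fin n) (ε : ℤ) (hε : ε = -1 ∨ ε = 1) :
    Pset n (ε • eZ n i) =
      {p | p i = -ε ∧ ∀ k : Fin n, k ≠ i → p k = 0 ∨ p k = -ε} := by
  ext p
  rw [mem_Pset_iff, forall_RnZ_neg_one_le_dotZ_iff, dotZ_smul, dotZ_eZ, Set.mem_ofPred_eq]
  constructor
  · rintro ⟨hi, hb, hd⟩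
    refine ⟨by rcases hε with rfl | rfl <;> omega, fun k hk => ?_⟩
    have := hb k
    have := hd i k hk.symm
    have := hd k i hk
    rcases hε with rfl | rfl <;> omega
  · rintro ⟨hi, h⟩
    have hk (k : Fin n) : p k = 0 ∨ p k = -ε := by
      by_cases hki : k = i
      · exact .inr (hki ▸ hi)
      · exact h k hki
    refine ⟨by rcases hε with rfl | rfl <;> omega, fun k => ?_, fun j k _ => ?_⟩
    · have := hk k
      omega
    · have := hk j
      have := hk k
      omega
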